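/- Let D ⊆ ℝⁿ be open, let H : D × ℝⁿ → ℝ be continuous and satisfy (H1)–(H3), let ℓ(x,y) := sup{⟨y,θ⟩ : θ ∈ ℝⁿ, H(x,θ) ≤ 0}, and set b(x) := H_θ(x,0) for x ∈ D. Then for every compact K ⊆ D there exists a constant A > 0 such that ℓ(x,y) ≥ A·(|b(x)|·|y| − ⟨b(x), y⟩) for all x ∈ K and all y ∈ ℝⁿ. -/

import Mathlib

open MeasureTheory Set Filter
open scoped RealInnerProductSpace

abbrev Euc (n : ℕ) := EuclideanSpace ℝ (Fin n)

/-- Second order Taylor lower bound on the unit interval. -/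
theorem taylor_two_lower_bound {f f' f'' : ℝ → ℝ} {c : ℝ}
    (hf : ∀ t, HasDerivAt f (f' t) t) (hf' : ∀ t, HasDerivAt f' (f'' t) t)
    (hc : ∀ t ∈ Set.Icc (0 : ℝ) 1, c ≤ f'' t) :
    f 0 + f' 0 + c / 2 ≤ f 1 := by
  have hg : ∀ t, HasDerivAt (fun t => f t - c / 2 * t ^ 2) (f' t - c * t) t := fun t => by
    have := (hf t).sub ((hasDerivAt_pow 2 t).const_mul (c / 2))
    exact this.congr_deriv (by norm_num; ring)
  obtain ⟨ξ, hξ, h₁⟩ := exists_hasDerivAt_eq_slope _ _ one_pos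
    (fun t _ => (hg t).continuousAt.continuousWithinAt) (fun t _ => hg t)
  obtain ⟨η, hη, h₂⟩ := exists_hasDerivAt_eq_slope _ _ hξ.1
    (fun t _ => (hf' t).continuousAt.continuousWithinAt) (fun t _ => hf' t)
  have h₃ := hc η ⟨hη.1.le, hη.2.le.trans hξ.2.le⟩
  rw [h₂, le_div_iff₀ (by linarith [hξ.1])] at h₃
  norm_num at h₁
  linarith

section Hamiltonian

variable {E : Type*} [NormedAddCommGroup E] [InnerProductSpace ℝ E]
  {h : E → ℝ} {g : E → E} {g' : E → E →L[ℝ] E}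

theorem hasDerivAt_inner_comp_smul (hg' : ∀ θ, HasFDerivAt g (g' θ) θ)
    (θ : E) (t : ℝ) :
    HasDerivAt (fun t : ℝ => ⟪g (t • θ), θ⟫) ⟪θ, g' (t • θ) θ⟫ t := by
  have := ((hg' (t • θ)).comp_hasDerivAt t ((hasDerivAt_id t).smul_const θ)).inner ℝ
    (hasDerivAt_const t θ)
  simpa [real_inner_comm] using this

variable [CompleteSpace E]

theorem hasDerivAt_comp_smul_of_hasGradientAt (hg : ∀ θ, HasGradientAt h (g θ) θ)
    (θ : E) (t : ℝ) : HasDerivAt (fun t : ℝ => h (t • θ)) ⟪g (t • θ), θ⟫ t := by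
  have := (hg (t • θ)).hasFDerivAt.comp_hasDerivAt t ((hasDerivAt_id t).smul_const θ)
  exact this.congr_deriv (by simp)

theorem quadratic_lower_bound (hg : ∀ θ, HasGradientAt h (g θ) θ)
    (hg' : ∀ θ, HasFDerivAt g (g' θ) θ) {m : ℝ}
    (hm : ∀ θ ξ, m * ‖ξ‖ ^ 2 ≤ ⟪ξ, g' θ ξ⟫) (θ : E) :
    h 0 + ⟪g 0, θ⟫ + m * ‖θ‖ ^ 2 / 2 ≤ h θ := by
  simpa using taylor_two_lower_bound (hasDerivAt_comp_smul_of_hasGradientAt hg θ)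
    (hasDerivAt_inner_comp_smul hg' θ) fun t _ => hm (t • θ) θ

theorem quadratic_upper_bound (hg : ∀ θ, HasGradientAt h (g θ) θ)
    (hg' : ∀ θ, HasFDerivAt g (g' θ) θ) {M R : ℝ}
    (hM : ∀ θ, ‖θ‖ ≤ R → ‖g' θ‖ ≤ M) {θ : E} (hθ : ‖θ‖ ≤ R) :
    h θ ≤ h 0 + ⟪g 0, θ⟫ + M * ‖θ‖ ^ 2 / 2 := by
  have key := taylor_two_lower_bound (c := -(M * ‖θ‖ ^ 2))
    (fun t => (hasDerivAt_comp_smul_of_hasGradientAt hg θ t).neg)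
    (fun t => (hasDerivAt_inner_comp_smul hg' θ t).neg) fun t ht => by
      have hR : ‖t • θ‖ ≤ R := by
        rw [norm_smul, Real.norm_of_nonneg ht.1]
        exact (mul_le_of_le_one_left (norm_nonneg _) ht.2).trans hθ
      have h₁ : ‖g' (t • θ) θ‖ ≤ M * ‖θ‖ := (g' (t • θ)).le_of_opNorm_le (hM _ hR) θ
      have h₂ := real_inner_le_norm θ (g' (t • θ) θ)
      have h₃ := mul_le_mul_of_nonneg_left h₁ (norm_nonneg θ)
      exact neg_le_neg (by linarith)
  simp only [Pi.neg_apply, zero_smul, one_smul] at key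
  linarith

/-- Strong convexity makes linear functionals bounded above on the zero sublevel set. -/
theorem bddAbove_inner_image_sublevel (hg : ∀ θ, HasGradientAt h (g θ) θ)
    (hg' : ∀ θ, HasFDerivAt g (g' θ) θ) {m : ℝ} (hm₀ : 0 < m)
    (hm : ∀ θ ξ, m * ‖ξ‖ ^ 2 ≤ ⟪ξ, g' θ ξ⟫) (y : E) :
    BddAbove ((fun θ => ⟪y, θ⟫) '' {θ | h θ ≤ 0}) := by
  refine ⟨-h 0 + ‖y - g 0‖ ^ 2 / (2 * m), ?_⟩
  rintro _ ⟨θ, hθ, rfl⟩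
  have h₁ := (quadratic_lower_bound hg hg' hm θ).trans hθ
  have h₂ := real_inner_le_norm (y - g 0) θ
  rw [inner_sub_left] at h₂
  have h₃ : ‖y - g 0‖ * ‖θ‖ - m * ‖θ‖ ^ 2 / 2 ≤ ‖y - g 0‖ ^ 2 / (2 * m) := by
    rw [le_div_iff₀ (by positivity)]
    nlinarith [sq_nonneg (‖y - g 0‖ - m * ‖θ‖)]
  simp only
  linarith

/-- The zero sublevel set contains a momentum realizing the drift lower bound. -/
theorem exists_sublevel_inner_eq (hg : ∀ θ, HasGradientAt h (g θ) θ)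
    (hg' : ∀ θ, HasFDerivAt g (g' θ) θ) (h₀ : h 0 ≤ 0) {M B A : ℝ}
    (hB : ‖g 0‖ ≤ B) (hM : ∀ θ, ‖θ‖ ≤ 2 * B → ‖g' θ‖ ≤ M)
    (hA : 0 ≤ A) (hA₁ : A ≤ 1) (hAM : A * M ≤ 1) (y : E) :
    ∃ θ, h θ ≤ 0 ∧ ⟪y, θ⟫ = A * (‖g 0‖ * ‖y‖ - ⟪g 0, y⟫) := by
  rcases eq_or_ne y 0 with rfl | hy
  · exact ⟨0, h₀, by simp⟩
  have hy' : ‖y‖ ≠ 0 := norm_ne_zero_iff.2 hy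
  set b := g 0
  set u : E := ‖y‖⁻¹ • y
  set v : E := ‖b‖ • u - b with hv
  have hu : ‖u‖ = 1 := by simp [u, norm_smul, hy']
  have hbv : ⟪b, v⟫ = ‖b‖ * ⟪b, u⟫ - ‖b‖ ^ 2 := by
    rw [hv, inner_sub_right, inner_smul_right, real_inner_self_eq_norm_sq]
  have hv_sq : ‖v‖ ^ 2 = -2 * ⟪b, v⟫ := by
    rw [hbv, hv, norm_sub_sq_real, norm_smul, norm_norm, hu, inner_smul_left,
      real_inner_comm]
    simp
    ring
  have hv_norm : ‖v‖ ≤ 2 * B := by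
    have := norm_sub_le (‖b‖ • u) b
    rw [norm_smul, norm_norm, hu, mul_one] at this
    linarith
  have hAv : ‖A • v‖ ≤ 2 * B := by
    rw [norm_smul, Real.norm_of_nonneg hA]
    exact (mul_le_of_le_one_left (norm_nonneg _) hA₁).trans hv_norm
  refine ⟨A • v, ?_, ?_⟩
  · have key := quadratic_upper_bound hg hg' hM hAv
    rw [inner_smul_right, norm_smul, Real.norm_of_nonneg hA, mul_pow] at key
    have h₁ : A * ⟪b, v⟫ + M * (A ^ 2 * ‖v‖ ^ 2) / 2 = -(A * (1 - A * M) * ‖v‖ ^ 2 / 2) := by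
      rw [hv_sq]
      ring
    have h₂ : 0 ≤ A * (1 - A * M) * ‖v‖ ^ 2 / 2 := by
      have := sub_nonneg.2 hAM
      positivity
    linarith
  · rw [inner_smul_right, hv, inner_sub_right, inner_smul_right, inner_smul_right,
      real_inner_self_eq_norm_sq, real_inner_comm b y]
    field_simp

end Hamiltonian

/-- the natural drift `b(x) = H_θ(x,0)` of a Hamiltonian geometric
action satisfies the drift lower bound
`ℓ(x,y) ≥ A (|b(x)||y| − ⟨b(x),y⟩)` locally uniformly on compacts. -/
theorem statement5 {n : ℕ}
    (D : Set (Euc n)) (hD : IsOpen D) (hDne : D.Nonempty)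
    (H : Euc n → Euc n → ℝ)
    (Hθ : Euc n → Euc n → Euc n)
    (Hθθ : Euc n → Euc n → (Euc n →L[ℝ] Euc n))
    (hHcont : ContinuousOn (fun p : Euc n × Euc n => H p.1 p.2) (D ×ˢ Set.univ))
    (hH1 : ∀ x ∈ D, H x 0 ≤ 0)
    (hHθ : ∀ x ∈ D, ∀ θ : Euc n, HasGradientAt (H x) (Hθ x θ) θ)
    (hHθθ : ∀ x ∈ D, ∀ θ : Euc n, HasFDerivAt (Hθ x) (Hθθ x θ) θ)
    (hHθcont : ContinuousOn (fun p : Euc n × Euc n => Hθ p.1 p.2) (D ×ˢ Set.univ))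
    (hHθθcont : ContinuousOn (fun p : Euc n × Euc n => Hθθ p.1 p.2) (D ×ˢ Set.univ))
    (hH3 : ∀ K ⊆ D, IsCompact K → ∃ m > (0:ℝ), ∀ x ∈ K, ∀ θ ξ : Euc n,
      m * ‖ξ‖ ^ 2 ≤ ⟪ξ, Hθθ x θ ξ⟫)
    (ℓ : Euc n → Euc n → ℝ)
    (hℓdef : ∀ x y : Euc n, ℓ x y = sSup ((fun θ => ⟪y, θ⟫) '' {θ | H x θ ≤ 0})) :
    ∀ K ⊆ D, IsCompact K → ∃ A > (0:ℝ), ∀ x ∈ K, ∀ y : Euc n,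
      A * (‖Hθ x 0‖ * ‖y‖ - ⟪Hθ x 0, y⟫) ≤ ℓ x y := by
  intro K hKD hK
  obtain ⟨m, hm₀, hm⟩ := hH3 K hKD hK
  obtain ⟨B, hB⟩ := (hK.prod (isCompact_singleton (x := (0 : Euc n)))).exists_bound_of_continuousOn
    (hHθcont.mono (Set.prod_mono hKD (Set.subset_univ _)))
  obtain ⟨M, hM⟩ := (hK.prod
    (isCompact_closedBall (0 : Euc n) (2 * B))).exists_bound_of_continuousOn
    (hHθθcont.mono (Set.prod_mono hKD (Set.subset_univ _)))
  have hM' : 0 < max M 1 := lt_max_of_lt_right one_pos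
  refine ⟨(max M 1)⁻¹, inv_pos.2 hM', fun x hx y => ?_⟩
  have hxD := hKD hx
  obtain ⟨θ, hθ, hy⟩ := exists_sublevel_inner_eq (hHθ x hxD) (hHθθ x hxD) (hH1 x hxD)
    (hB (x, 0) ⟨hx, rfl⟩)
    (fun θ hθ => (hM (x, θ) ⟨hx, mem_closedBall_zero_iff.2 hθ⟩).trans (le_max_left M 1))
    (inv_pos.2 hM').le (inv_le_one_of_one_le₀ (le_max_right M 1))
    (inv_mul_cancel₀ hM'.ne').le y
  rw [hℓdef, ← hy]
  exact le_csSup (bddAbove_inner_image_sublevel (hHθ x hxD) (hHθθ x hxD) hm₀ (hm x hx) y)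
    ⟨θ, hθ, rfl⟩
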